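/- arXiv:2501.15419 — 3 statements merged into one kernel-verified Lean document; each statement's English description precedes it below -/
import Mathlib

section
/- Under the inner-iteration setting, assume in addition that lim_{ℓ→∞} max_{1≤i≤m} |z^ℓ_i − μ/g_i(x^ℓ)| = 0 and that there is κ_E > 0 such that for every ε > 0 and every ℓ with λ_min[H^ℓ] < −ε one has pred^ℓ ≥ κ_E ε (Δ^ℓ)². Then limsup_{ℓ→∞} λ_min[H(x^ℓ, z^ℓ)] ≥ 0. -/
open Filter Topology
open scoped RealInnerProductSpace BigOperators

noncomputable section

variable {E : Type*} [NormedAddCommGroup E] [InnerProductSpace ℝ E] [FiniteDimensional ℝ E]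

/-- A forcing function: continuous on `[0,∞)`, nonnegative there, vanishing exactly at `0`. -/
def IsForcing (ρ : ℝ → ℝ) : Prop :=
  ContinuousOn ρ (Set.Ici 0) ∧ (∀ t, 0 ≤ t → 0 ≤ ρ t) ∧ ∀ t, 0 ≤ t → (ρ t = 0 ↔ t = 0)

/-- The Hessian of `h` at `x`, i.e. the derivative of the gradient field of `h` at `x`. -/
def Hess (h : E → ℝ) (x : E) : E →L[ℝ] E := fderiv ℝ (gradient h) x

/-- Gradient of the Lagrangian `L(x,z) = f(x) - ∑ i, z i * g i x` with respect to `x`. -/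
def gradL {m : ℕ} (f : E → ℝ) (g : Fin m → E → ℝ) (x : E) (z : Fin m → ℝ) : E :=
  gradient f x - ∑ i, z i • gradient (g i) x

/-- Hessian of the Lagrangian with respect to `x`. -/
def hessL {m : ℕ} (f : E → ℝ) (g : Fin m → E → ℝ) (x : E) (z : Fin m → ℝ) : E →L[ℝ] E :=
  Hess f x - ∑ i, z i • Hess (g i) x

/-- The condensed primal-dual operator `H(x,z)`,
`H(x,z) v = Hess_x L(x,z) v + ∑ i (z i / g i x) ⟪∇g i x, v⟫ ∇g i x`. -/
def Hxz {m : ℕ} (f : E → ℝ) (g : Fin m → E → ℝ) (x : E) (z : Fin m → ℝ) : E →L[ℝ] E :=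
  hessL f g x z +
    ∑ i, (z i / g i x) • ((innerSL ℝ (gradient (g i) x)).smulRight (gradient (g i) x))

/-- Smallest Rayleigh-quotient value of `A` over the unit sphere. -/
def lamMin (A : E →L[ℝ] E) : ℝ := sInf ((fun v => ⟪A v, v⟫) '' {v : E | ‖v‖ = 1})

/-- The log-barrier merit function `φ_μ`. -/
def barrierPhi {m : ℕ} (μ : ℝ) (f : E → ℝ) (g : Fin m → E → ℝ) (x : E) : ℝ :=
  f x - μ * ∑ i, Real.log (g i x)

/-- The barrier gradient `q_μ(x) = ∇f(x) - μ ∑ i ∇g i (x) / g i x`. -/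
def qmu {m : ℕ} (μ : ℝ) (f : E → ℝ) (g : Fin m → E → ℝ) (x : E) : E :=
  gradient f x - μ • ∑ i, (g i x)⁻¹ • gradient (g i) x

/-- Trust-region model `m_{x,z,μ}(d)`. -/
def trModel {m : ℕ} (μ : ℝ) (f : E → ℝ) (g : Fin m → E → ℝ) (x : E) (z : Fin m → ℝ)
    (d : E) : ℝ :=
  (1/2) * ⟪Hxz f g x z d, d⟫ + ⟪qmu μ f g x, d⟫

/-- Predicted reduction of the step `d`. -/
def predRed {m : ℕ} (μ : ℝ) (f : E → ℝ) (g : Fin m → E → ℝ) (x : E) (z : Fin m → ℝ)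
    (d : E) : ℝ :=
  - trModel μ f g x z d

/-- Actual reduction of the step `d`. -/
def aredRed {m : ℕ} (μ : ℝ) (f : E → ℝ) (g : Fin m → E → ℝ) (x : E) (d : E) : ℝ :=
  barrierPhi μ f g x - barrierPhi μ f g (x + d)


/-- The inner-iteration setting of the interior-point trust-region method (with the
log-barrier merit function), including all standing assumptions. -/
structure InnerSetting (m : ℕ) (f : E → ℝ) (g : Fin m → E → ℝ)
    (μ τ κC ω Δmax : ℝ)
    (x : ℕ → E) (z : ℕ → Fin m → ℝ) (d : ℕ → E) (Δ : ℕ → ℝ) : Prop where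
  hm : 1 ≤ m
  hf : ContDiff ℝ 2 f
  hg : ∀ i, ContDiff ℝ 2 (g i)
  hμ : 0 < μ
  hτ : 0 < τ ∧ τ < 1/4
  hκC : 0 < κC
  hω : 0 < ω ∧ ω < 1
  hΔmax : 0 < Δmax
  hΔ : ∀ ℓ, 0 < Δ ℓ ∧ Δ ℓ ≤ Δmax
  /-- (i) strict feasibility of the iterates -/
  hgpos : ∀ ℓ i, 0 < g i (x ℓ)
  hzpos : ∀ ℓ i, 0 < z ℓ i
  /-- (ii) the step is inside the trust region -/
  hdΔ : ∀ ℓ, ‖d ℓ‖ ≤ Δ ℓ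
  /-- (iii) Cauchy decrease, case `H^ℓ = 0` -/
  cauchy_zero : ∀ ℓ, Hxz f g (x ℓ) (z ℓ) = 0 →
    κC * ‖qmu μ f g (x ℓ)‖ * Δ ℓ ≤ predRed μ f g (x ℓ) (z ℓ) (d ℓ)
  /-- (iii) Cauchy decrease, case `H^ℓ ≠ 0` -/
  cauchy : ∀ ℓ, Hxz f g (x ℓ) (z ℓ) ≠ 0 →
    κC * ‖qmu μ f g (x ℓ)‖ *
        min (Δ ℓ) (‖qmu μ f g (x ℓ)‖ / ‖Hxz f g (x ℓ) (z ℓ)‖) ≤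
      predRed μ f g (x ℓ) (z ℓ) (d ℓ)
  /-- (iv) update on a successful iteration -/
  succ_update : ∀ ℓ, ((∀ i, 0 < g i (x ℓ + d ℓ)) ∧
      τ * predRed μ f g (x ℓ) (z ℓ) (d ℓ) < aredRed μ f g (x ℓ) (d ℓ)) →
    x (ℓ + 1) = x ℓ + d ℓ
  /-- (iv) update on an unsuccessful iteration -/
  fail_update : ∀ ℓ, ¬((∀ i, 0 < g i (x ℓ + d ℓ)) ∧
      τ * predRed μ f g (x ℓ) (z ℓ) (d ℓ) < aredRed μ f g (x ℓ) (d ℓ)) →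
    x (ℓ + 1) = x ℓ ∧ z (ℓ + 1) = z ℓ
  /-- (v) radius update: infeasible trial point -/
  Δ_infeas : ∀ ℓ, (∃ i, g i (x ℓ + d ℓ) ≤ 0) → Δ (ℓ + 1) = ω * ‖d ℓ‖
  /-- (v) radius update: shrink -/
  Δ_shrink : ∀ ℓ, (∀ i, 0 < g i (x ℓ + d ℓ)) →
    aredRed μ f g (x ℓ) (d ℓ) < predRed μ f g (x ℓ) (z ℓ) (d ℓ) / 4 →
    Δ (ℓ + 1) = Δ ℓ / 4
  /-- (v) radius update: expand -/
  Δ_expand : ∀ ℓ, (∀ i, 0 < g i (x ℓ + d ℓ)) →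
    (3/4) * predRed μ f g (x ℓ) (z ℓ) (d ℓ) ≤ aredRed μ f g (x ℓ) (d ℓ) →
    ‖d ℓ‖ = Δ ℓ → Δ (ℓ + 1) = min (2 * Δ ℓ) Δmax
  /-- (v) radius update: remaining cases -/
  Δ_keep : ∀ ℓ, (∀ i, 0 < g i (x ℓ + d ℓ)) →
    ¬(aredRed μ f g (x ℓ) (d ℓ) < predRed μ f g (x ℓ) (z ℓ) (d ℓ) / 4) →
    ¬((3/4) * predRed μ f g (x ℓ) (z ℓ) (d ℓ) ≤ aredRed μ f g (x ℓ) (d ℓ) ∧ ‖d ℓ‖ = Δ ℓ) →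
    Δ (ℓ + 1) = Δ ℓ
  /-- uniform bounds along the iterates -/
  bound_fbelow : ∃ Lb : ℝ, ∀ ℓ, Lb ≤ f (x ℓ)
  bound_g : ∃ U > (0:ℝ), ∀ ℓ i, g i (x ℓ) ≤ U
  bound_gradg : ∃ Cg > (0:ℝ), ∀ ℓ i, ‖gradient (g i) (x ℓ)‖ ≤ Cg
  bound_hessg : ∃ CG > (0:ℝ), ∀ ℓ i, ‖Hess (g i) (x ℓ)‖ ≤ CG
  bound_hessf : ∃ Cf > (0:ℝ), ∀ ℓ, ‖Hess f (x ℓ)‖ ≤ Cf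
  bound_z : ∃ Cz > (0:ℝ), ∀ ℓ i, z ℓ i ≤ Cz
  /-- uniform continuity of each `g i` along the iterates -/
  unif_cont : ∀ η > (0:ℝ), ∃ δ > (0:ℝ), ∀ ℓ i (v : E), ‖v‖ ≤ δ →
    |g i (x ℓ + v) - g i (x ℓ)| ≤ η
  /-- radial Lipschitz bound for the gradients of the constraints -/
  radial_grad : ∃ β₁ > (0:ℝ), ∃ δ₁ > (0:ℝ), ∀ ℓ i (t : ℝ) (v : E), 0 ≤ t → t * ‖v‖ ≤ δ₁ →
    |⟪gradient (g i) (x ℓ + t • v) - gradient (g i) (x ℓ), v⟫| ≤ β₁ * t * ‖v‖ ^ 2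
  /-- radial Lipschitz bound for the Hessians of `f` and of the constraints -/
  radial_hess : ∃ β₂ > (0:ℝ), ∃ δ₂ > (0:ℝ), ∀ ℓ (t : ℝ) (v : E), 0 ≤ t → t * ‖v‖ ≤ δ₂ →
    |⟪(Hess f (x ℓ + t • v) - Hess f (x ℓ)) v, v⟫| ≤ β₂ * t * ‖v‖ ^ 3 ∧
    ∀ i, |⟪(Hess (g i) (x ℓ + t • v) - Hess (g i) (x ℓ)) v, v⟫| ≤ β₂ * t * ‖v‖ ^ 3


theorem hasDerivAt_comp_line {h : E → ℝ} (hh : ContDiff ℝ 2 h) (x v : E) (t : ℝ) :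
    HasDerivAt (fun s : ℝ => h (x + s • v)) ⟪gradient h (x + t • v), v⟫ t := by
  have hline : HasDerivAt (fun s : ℝ => x + s • v) v t := by
    simpa using ((hasDerivAt_id t).smul_const v).const_add x
  have hd : DifferentiableAt ℝ h (x + t • v) := hh.differentiable (by norm_num) _
  have := hd.hasGradientAt.hasFDerivAt.comp_hasDerivAt t hline
  simpa [Function.comp_def] using this

theorem hasDerivAt_inner_gradient_line {h : E → ℝ} (hh : ContDiff ℝ 2 h) (x v : E) (t : ℝ) :
    HasDerivAt (fun s : ℝ => ⟪gradient h (x + s • v), v⟫) ⟪Hess h (x + t • v) v, v⟫ t := by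
  have hline : HasDerivAt (fun s : ℝ => x + s • v) v t := by
    simpa using ((hasDerivAt_id t).smul_const v).const_add x
  have hgrad : ContDiff ℝ 1 (gradient h) :=
    (InnerProductSpace.toDual ℝ E).symm.contDiff.comp (hh.fderiv_right (by norm_num))
  have hd : DifferentiableAt ℝ (gradient h) (x + t • v) := hgrad.differentiable (by norm_num) _
  have := (hd.hasFDerivAt.comp_hasDerivAt t hline).inner ℝ (hasDerivAt_const t v)
  simpa [Hess] using this

theorem abs_sub_le_of_abs_deriv_le {r r' : ℝ → ℝ} {B : ℝ} (h0 : r 0 = 0)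
    (hr : ∀ t, HasDerivAt r (r' t) t) (hB : ∀ t ∈ Set.Icc (0 : ℝ) 1, |r' t| ≤ B) :
    ∀ t ∈ Set.Icc (0 : ℝ) 1, |r t| ≤ B := by
  intro t ht
  have hB0 : 0 ≤ B := (abs_nonneg _).trans (hB t ht)
  have := (convex_Icc (0 : ℝ) 1).norm_image_sub_le_of_norm_hasDerivWithin_le
    (fun s _ => (hr s).hasDerivWithinAt) (fun s hs => hB s hs)
    (Set.left_mem_Icc.2 zero_le_one) ht
  rw [h0, sub_zero, sub_zero, Real.norm_eq_abs, Real.norm_eq_abs, abs_of_nonneg ht.1] at this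
  nlinarith [ht.2]

theorem abs_second_order_remainder_le {h : E → ℝ} (hh : ContDiff ℝ 2 h) (x v : E) {B : ℝ}
    (hB : ∀ t ∈ Set.Icc (0 : ℝ) 1, |⟪(Hess h (x + t • v) - Hess h x) v, v⟫| ≤ B) :
    |h (x + v) - h x - ⟪gradient h x, v⟫ - ⟪Hess h x v, v⟫ / 2| ≤ B := by
  have h1 := abs_sub_le_of_abs_deriv_le
    (r := fun t => ⟪gradient h (x + t • v), v⟫ - ⟪gradient h x, v⟫ - t * ⟪Hess h x v, v⟫)
    (r' := fun t => ⟪(Hess h (x + t • v) - Hess h x) v, v⟫) (B := B) (by simp)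
    (fun t => by
      have := ((hasDerivAt_inner_gradient_line hh x v t).sub_const ⟪gradient h x, v⟫).sub
        ((hasDerivAt_id t).mul_const ⟪Hess h x v, v⟫)
      exact this.congr_deriv (by simp [inner_sub_left])) hB
  have h2 := abs_sub_le_of_abs_deriv_le
    (r := fun t => h (x + t • v) - h x - t * ⟪gradient h x, v⟫ - t ^ 2 / 2 * ⟪Hess h x v, v⟫)
    (B := B) (by simp)
    (fun t => by
      have := (((hasDerivAt_comp_line hh x v t).sub_const (h x)).sub
        ((hasDerivAt_id t).mul_const ⟪gradient h x, v⟫)).sub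
        ((((hasDerivAt_id t).pow 2).div_const 2).mul_const ⟪Hess h x v, v⟫)
      exact this.congr_deriv (by simp)) h1 1 (Set.right_mem_Icc.2 zero_le_one)
  simp only [one_smul] at h2
  convert h2 using 2
  ring

theorem abs_log_one_add_sub_le {s : ℝ} (hs : |s| ≤ 1 / 2) :
    |Real.log (1 + s) - s + s ^ 2 / 2| ≤ 2 * |s| ^ 3 := by
  have h := Real.abs_log_sub_add_sum_range_le (x := -s) (by rw [abs_neg]; linarith) 2
  rw [abs_neg] at h
  have h3 : |s| ^ 3 / (1 - |s|) ≤ 2 * |s| ^ 3 := by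
    rw [div_le_iff₀ (by linarith)]
    nlinarith [pow_nonneg (abs_nonneg s) 3]
  calc |Real.log (1 + s) - s + s ^ 2 / 2| = _ := by
        simp only [Finset.sum_range_succ, Finset.sum_range_zero, sub_neg_eq_add]
        congr 1
        push_cast
        ring
    _ ≤ _ := h.trans h3

/-- Second-order expansion of the logarithm of a function with value `y`, first- and
second-order terms `a` and `b`, and increment `w`. -/
theorem abs_log_add_sub_le {y w a b c A B β n : ℝ} (hc : 0 < c) (hy : c ≤ y) (hA : 0 ≤ A)
    (hB : 0 ≤ B) (hβ : 0 ≤ β) (hn : 0 ≤ n) (hn1 : n ≤ 1) (hnc : (A + B + β) * n ≤ c / 2)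
    (ha : |a| ≤ A * n) (hb : |b| ≤ B * n ^ 2) (hw : |w - a - b / 2| ≤ β * n ^ 3) :
    0 < y + w ∧ |Real.log (y + w) - Real.log y - (a / y + b / (2 * y) - a ^ 2 / (2 * y ^ 2))| ≤
      (β / c + (A + B + β) ^ 2 / c ^ 2 + 2 * (A + B + β) ^ 3 / c ^ 3) * n ^ 3 := by
  set K := A + B + β with hK
  have hK0 : 0 ≤ K := by positivity
  have hy0 : 0 < y := hc.trans_le hy
  have hn32 : n ^ 3 ≤ n ^ 2 := pow_le_pow_of_le_one hn hn1 (by norm_num)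
  have hn21 : n ^ 2 ≤ n := by nlinarith
  have hwa : |w - a| ≤ K * n ^ 2 := by
    rw [abs_le] at hw hb ⊢
    constructor <;> nlinarith [mul_nonneg hA (sq_nonneg n), mul_nonneg hB (sq_nonneg n),
      mul_le_mul_of_nonneg_left hn32 hβ]
  have hwn : |w| ≤ K * n := by
    rw [abs_le] at hw hb ha ⊢
    constructor <;> nlinarith [mul_le_mul_of_nonneg_left hn21 hB, mul_nonneg hB (sq_nonneg n),
      mul_le_mul_of_nonneg_left (hn32.trans hn21) hβ]
  have han : |a| ≤ K * n := ha.trans (by gcongr; linarith)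
  have hsn : |w / y| ≤ K * n / c := by
    rw [abs_div, abs_of_pos hy0]; gcongr
  have hs : |w / y| ≤ 1 / 2 := hsn.trans (by rw [div_le_iff₀ hc]; linarith)
  have hyw : y + w = y * (1 + w / y) := by field_simp
  have hpos : 0 < 1 + w / y := by linarith [(abs_le.1 hs).1]
  refine ⟨by rw [hyw]; positivity, ?_⟩
  have e1 : |(w - a - b / 2) / y| ≤ β / c * n ^ 3 := by
    rw [abs_div, abs_of_pos hy0]
    calc _ ≤ β * n ^ 3 / c := by gcongr
      _ = _ := by ring
  have e2 : |(w - a) * (w + a) / (2 * y ^ 2)| ≤ K ^ 2 / c ^ 2 * n ^ 3 := by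
    rw [abs_div, abs_mul, abs_of_pos (show 0 < 2 * y ^ 2 by positivity)]
    have : |w + a| ≤ 2 * (K * n) := (abs_add_le _ _).trans (by linarith)
    calc _ ≤ (K * n ^ 2) * (2 * (K * n)) / (2 * c ^ 2) := by gcongr
      _ = _ := by field_simp
  have e3 : |Real.log (1 + w / y) - w / y + (w / y) ^ 2 / 2| ≤ 2 * K ^ 3 / c ^ 3 * n ^ 3 := by
    refine (abs_log_one_add_sub_le hs).trans ?_
    calc _ ≤ 2 * (K * n / c) ^ 3 := by gcongr
      _ = _ := by field_simp
  have key : Real.log (y + w) - Real.log y - (a / y + b / (2 * y) - a ^ 2 / (2 * y ^ 2)) =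
      (w - a - b / 2) / y - (w - a) * (w + a) / (2 * y ^ 2) +
        (Real.log (1 + w / y) - w / y + (w / y) ^ 2 / 2) := by
    rw [hyw, Real.log_mul hy0.ne' hpos.ne']
    field_simp
    ring
  rw [key]
  rw [abs_le] at e1 e2 e3 ⊢
  constructor <;> linarith

theorem inner_Hxz_apply {m : ℕ} (f : E → ℝ) (g : Fin m → E → ℝ) (x : E) (z : Fin m → ℝ) (v : E) :
    ⟪Hxz f g x z v, v⟫ = ⟪Hess f x v, v⟫ +
      ∑ i, z i * (⟪gradient (g i) x, v⟫ ^ 2 / g i x - ⟪Hess (g i) x v, v⟫) := by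
  simp only [Hxz, hessL, add_apply, sub_apply,
    sum_apply, smul_apply, inner_add_left, inner_sub_left,
    sum_inner, real_inner_smul_left, ContinuousLinearMap.smulRight_apply, innerSL_apply_apply]
  rw [sub_add_eq_add_sub, add_sub_assoc, ← Finset.sum_sub_distrib]
  congr 1
  refine Finset.sum_congr rfl fun i _ => ?_
  ring

theorem inner_qmu {m : ℕ} (μ : ℝ) (f : E → ℝ) (g : Fin m → E → ℝ) (x v : E) :
    ⟪qmu μ f g x, v⟫ = ⟪gradient f x, v⟫ - ∑ i, μ * (⟪gradient (g i) x, v⟫ / g i x) := by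
  simp only [qmu, inner_sub_left, real_inner_smul_left, sum_inner, Finset.mul_sum]
  congr 1
  refine Finset.sum_congr rfl fun i _ => ?_
  ring

theorem abs_inner_apply_self_le {F : Type*} [NormedAddCommGroup F] [InnerProductSpace ℝ F]
    (A : F →L[ℝ] F) (v : F) {C : ℝ} (hA : ‖A‖ ≤ C) :
    |⟪A v, v⟫| ≤ C * ‖v‖ ^ 2 := by
  calc |⟪A v, v⟫| ≤ ‖A v‖ * ‖v‖ := abs_real_inner_le_norm _ _
    _ ≤ (C * ‖v‖) * ‖v‖ := by gcongr; exact A.le_of_opNorm_le hA v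
    _ = _ := by ring

/-- Accuracy of the trust-region model for the barrier function. -/
theorem abs_aredRed_sub_predRed_le {m : ℕ} {f : E → ℝ} {g : Fin m → E → ℝ} {μ : ℝ} {x : E}
    {z : Fin m → ℝ} {v : E} {c A B β η : ℝ} (hf : ContDiff ℝ 2 f) (hg : ∀ i, ContDiff ℝ 2 (g i))
    (hμ : 0 ≤ μ) (hc : 0 < c) (hgc : ∀ i, c ≤ g i x) (hA : 0 ≤ A) (hB : 0 ≤ B) (hβ : 0 ≤ β)
    (hgradg : ∀ i, ‖gradient (g i) x‖ ≤ A) (hhessg : ∀ i, ‖Hess (g i) x‖ ≤ B)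
    (hradf : ∀ t ∈ Set.Icc (0 : ℝ) 1, |⟪(Hess f (x + t • v) - Hess f x) v, v⟫| ≤ β * ‖v‖ ^ 3)
    (hradg : ∀ i, ∀ t ∈ Set.Icc (0 : ℝ) 1,
      |⟪(Hess (g i) (x + t • v) - Hess (g i) x) v, v⟫| ≤ β * ‖v‖ ^ 3)
    (hη : ∀ i, |z i - μ / g i x| ≤ η) (hv1 : ‖v‖ ≤ 1) (hvc : (A + B + β) * ‖v‖ ≤ c / 2) :
    (∀ i, 0 < g i (x + v)) ∧ |aredRed μ f g x v - predRed μ f g x z v| ≤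
      (β + m * (μ * (β / c + (A + B + β) ^ 2 / c ^ 2 + 2 * (A + B + β) ^ 3 / c ^ 3))) * ‖v‖ ^ 3 +
        m * (η * (B + A ^ 2 / c)) * ‖v‖ ^ 2 := by
  set C := β / c + (A + B + β) ^ 2 / c ^ 2 + 2 * (A + B + β) ^ 3 / c ^ 3
  have hgrad : ∀ i, |⟪gradient (g i) x, v⟫| ≤ A * ‖v‖ := fun i =>
    (abs_real_inner_le_norm _ _).trans (by gcongr; exact hgradg i)
  have hhess : ∀ i, |⟪Hess (g i) x v, v⟫| ≤ B * ‖v‖ ^ 2 := fun i =>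
    abs_inner_apply_self_le _ _ (hhessg i)
  have hlog := fun i => abs_log_add_sub_le hc (hgc i) hA hB hβ (norm_nonneg v) hv1 hvc
    (hgrad i) (hhess i) (w := g i (x + v) - g i x)
    (abs_second_order_remainder_le (hg i) x v (hradg i))
  simp only [add_sub_cancel] at hlog
  refine ⟨fun i => (hlog i).1, ?_⟩
  have hRf := abs_second_order_remainder_le hf x v hradf
  have key : aredRed μ f g x v - predRed μ f g x z v =
      -(f (x + v) - f x - ⟪gradient f x, v⟫ - ⟪Hess f x v, v⟫ / 2) +
      ∑ i, (μ * (Real.log (g i (x + v)) - Real.log (g i x) - (⟪gradient (g i) x, v⟫ / g i x +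
          ⟪Hess (g i) x v, v⟫ / (2 * g i x) - ⟪gradient (g i) x, v⟫ ^ 2 / (2 * g i x ^ 2))) +
        (z i - μ / g i x) * (⟪gradient (g i) x, v⟫ ^ 2 / g i x - ⟪Hess (g i) x v, v⟫) / 2) := by
    have hsum : ∑ i, (μ * (Real.log (g i (x + v)) - Real.log (g i x) -
          (⟪gradient (g i) x, v⟫ / g i x +
          ⟪Hess (g i) x v, v⟫ / (2 * g i x) - ⟪gradient (g i) x, v⟫ ^ 2 / (2 * g i x ^ 2))) +
        (z i - μ / g i x) * (⟪gradient (g i) x, v⟫ ^ 2 / g i x - ⟪Hess (g i) x v, v⟫) / 2) =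
        μ * ∑ i, Real.log (g i (x + v)) - μ * ∑ i, Real.log (g i x) -
        ∑ i, μ * (⟪gradient (g i) x, v⟫ / g i x) +
        1 / 2 * ∑ i, z i * (⟪gradient (g i) x, v⟫ ^ 2 / g i x - ⟪Hess (g i) x v, v⟫) := by
      simp only [Finset.mul_sum, ← Finset.sum_sub_distrib, ← Finset.sum_add_distrib]
      refine Finset.sum_congr rfl fun i _ => ?_
      have := (hc.trans_le (hgc i)).ne'
      field_simp
      ring
    rw [hsum]
    simp only [aredRed, predRed, trModel, barrierPhi, inner_Hxz_apply, inner_qmu]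
    ring
  have hterm : ∀ i, |μ * (Real.log (g i (x + v)) - Real.log (g i x) -
        (⟪gradient (g i) x, v⟫ / g i x +
          ⟪Hess (g i) x v, v⟫ / (2 * g i x) - ⟪gradient (g i) x, v⟫ ^ 2 / (2 * g i x ^ 2))) +
        (z i - μ / g i x) * (⟪gradient (g i) x, v⟫ ^ 2 / g i x - ⟪Hess (g i) x v, v⟫) / 2| ≤
      μ * C * ‖v‖ ^ 3 + η * (B + A ^ 2 / c) * ‖v‖ ^ 2 := by
    intro i
    refine (abs_add_le _ _).trans (add_le_add ?_ ?_)
    · rw [abs_mul, abs_of_nonneg hμ, mul_assoc]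
      exact mul_le_mul_of_nonneg_left (hlog i).2 hμ
    · have h1 : |⟪gradient (g i) x, v⟫ ^ 2 / g i x - ⟪Hess (g i) x v, v⟫| ≤
          (B + A ^ 2 / c) * ‖v‖ ^ 2 := by
        have hgi : |⟪gradient (g i) x, v⟫ ^ 2 / g i x| ≤ A ^ 2 / c * ‖v‖ ^ 2 := by
          rw [abs_div, abs_of_pos (hc.trans_le (hgc i)), abs_pow]
          calc _ ≤ (A * ‖v‖) ^ 2 / c := by gcongr; exacts [hgrad i, hgc i]
            _ = _ := by ring
        have := abs_sub (⟪gradient (g i) x, v⟫ ^ 2 / g i x) ⟪Hess (g i) x v, v⟫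
        linarith [hhess i]
      have hη0 : 0 ≤ η := (abs_nonneg _).trans (hη i)
      rw [abs_div, abs_mul, abs_two]
      have := mul_le_mul (hη i) h1 (abs_nonneg _) hη0
      have h0 := mul_nonneg (abs_nonneg (z i - μ / g i x))
        (abs_nonneg (⟪gradient (g i) x, v⟫ ^ 2 / g i x - ⟪Hess (g i) x v, v⟫))
      linarith
  rw [key]
  refine (abs_add_le _ _).trans ?_
  rw [abs_neg]
  have hS := (Finset.abs_sum_le_sum_abs _ Finset.univ).trans
    (Finset.sum_le_sum fun i _ => hterm i)
  rw [Finset.sum_const, Finset.card_univ, Fintype.card_fin, nsmul_eq_mul] at hS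
  calc _ ≤ _ := add_le_add hRf hS
    _ = _ := by ring

namespace InnerSetting

variable {m : ℕ} {f : E → ℝ} {g : Fin m → E → ℝ} {μ τ κC ω Δmax : ℝ}
  {x : ℕ → E} {z : ℕ → Fin m → ℝ} {d : ℕ → E} {Δ : ℕ → ℝ}

theorem barrierPhi_bddBelow (hset : InnerSetting m f g μ τ κC ω Δmax x z d Δ) :
    ∃ b : ℝ, ∀ ℓ, b ≤ barrierPhi μ f g (x ℓ) := by
  obtain ⟨Lb, hLb⟩ := hset.bound_fbelow
  obtain ⟨U, hU, hgU⟩ := hset.bound_g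
  refine ⟨Lb - μ * (m * Real.log U), fun ℓ => sub_le_sub (hLb ℓ) ?_⟩
  refine mul_le_mul_of_nonneg_left ?_ hset.hμ.le
  have := Finset.sum_le_card_nsmul Finset.univ (fun i => Real.log (g i (x ℓ))) (Real.log U)
    fun i _ => Real.log_le_log (hset.hgpos ℓ i) (hgU ℓ i)
  simpa using this

/-- On a sublevel set of the barrier function the constraints stay away from zero. -/
theorem exists_pos_le_constraint (hset : InnerSetting m f g μ τ κC ω Δmax x z d Δ) (b : ℝ) :
    ∃ c > (0 : ℝ), ∀ ℓ, barrierPhi μ f g (x ℓ) ≤ b → ∀ i, c ≤ g i (x ℓ) := by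
  obtain ⟨Lb, hLb⟩ := hset.bound_fbelow
  obtain ⟨U, hU, hgU⟩ := hset.bound_g
  refine ⟨Real.exp (Real.log U - (m * Real.log U + (b - Lb) / μ)), Real.exp_pos _,
    fun ℓ hℓ i => ?_⟩
  rw [← Real.le_log_iff_exp_le (hset.hgpos ℓ i)]
  have h1 := Finset.single_le_sum (f := fun j => Real.log U - Real.log (g j (x ℓ)))
    (fun j _ => sub_nonneg.2 (Real.log_le_log (hset.hgpos ℓ j) (hgU ℓ j))) (Finset.mem_univ i)
  simp only [Finset.sum_sub_distrib, Finset.sum_const, Finset.card_univ, Fintype.card_fin,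
    nsmul_eq_mul] at h1
  have h2 : -∑ j, Real.log (g j (x ℓ)) ≤ (b - Lb) / μ := by
    rw [le_div_iff₀ hset.hμ]
    have := hLb ℓ
    simp only [barrierPhi] at hℓ
    linarith
  linarith

theorem barrierPhi_succ_le (hset : InnerSetting m f g μ τ κC ω Δmax x z d Δ) {ℓ : ℕ}
    (hpred : 0 ≤ predRed μ f g (x ℓ) (z ℓ) (d ℓ)) :
    barrierPhi μ f g (x (ℓ + 1)) ≤ barrierPhi μ f g (x ℓ) := by
  by_cases hs : (∀ i, 0 < g i (x ℓ + d ℓ)) ∧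
      τ * predRed μ f g (x ℓ) (z ℓ) (d ℓ) < aredRed μ f g (x ℓ) (d ℓ)
  · rw [hset.succ_update ℓ hs]
    have := hs.2
    simp only [aredRed] at this
    linarith [mul_nonneg hset.hτ.1.le hpred]
  · rw [(hset.fail_update ℓ hs).1]

/-- If the constraints stay away from zero and `z` approaches `μ / g`, the model error along
short steps is `o(‖d‖²)`. -/
theorem exists_abs_aredRed_sub_predRed_le (hset : InnerSetting m f g μ τ κC ω Δmax x z d Δ)
    (hz : ∀ i, Tendsto (fun ℓ => |z ℓ i - μ / g i (x ℓ)|) atTop (𝓝 0)) {c : ℝ} (hc : 0 < c)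
    {κ : ℝ} (hκ : 0 < κ) :
    ∃ δ > (0 : ℝ), ∀ᶠ ℓ in atTop, (∀ i, c ≤ g i (x ℓ)) → ‖d ℓ‖ ≤ δ →
      (∀ i, 0 < g i (x ℓ + d ℓ)) ∧
      |aredRed μ f g (x ℓ) (d ℓ) - predRed μ f g (x ℓ) (z ℓ) (d ℓ)| ≤ κ * ‖d ℓ‖ ^ 2 := by
  obtain ⟨A, hA, hgA⟩ := hset.bound_gradg
  obtain ⟨B, hB, hgB⟩ := hset.bound_hessg
  obtain ⟨β, hβ, δ₂, hδ₂, hrad⟩ := hset.radial_hess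
  have hμ := hset.hμ
  set P := β + m * (μ * (β / c + (A + B + β) ^ 2 / c ^ 2 + 2 * (A + B + β) ^ 3 / c ^ 3)) with hP
  set Q := m * (B + A ^ 2 / c) with hQ
  have hP0 : 0 < P := by positivity
  have hQ0 : 0 ≤ Q := by positivity
  have hη : 0 < κ / (2 * (Q + 1)) := by positivity
  refine ⟨min (min δ₂ 1) (min (c / (2 * (A + B + β))) (κ / (2 * P))), by positivity, ?_⟩
  filter_upwards [eventually_all.2 fun i => (hz i).eventually_le_const hη] with ℓ hzℓ hgc hd
  simp only [le_min_iff] at hd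
  obtain ⟨⟨hd1, hd2⟩, hd3, hd4⟩ := hd
  have hline : ∀ t ∈ Set.Icc (0 : ℝ) 1, 0 ≤ t ∧ t * ‖d ℓ‖ ≤ δ₂ ∧
      β * t * ‖d ℓ‖ ^ 3 ≤ β * ‖d ℓ‖ ^ 3 := fun t ht =>
    ⟨ht.1, (mul_le_of_le_one_left (norm_nonneg _) ht.2).trans hd1, by
      gcongr; exact mul_le_of_le_one_right hβ.le ht.2⟩
  obtain ⟨h1, h2⟩ := abs_aredRed_sub_predRed_le (β := β) hset.hf hset.hg hμ.le hc hgc hA.le hB.le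
    hβ.le (hgA ℓ) (hgB ℓ)
    (fun t ht => (hrad ℓ t (d ℓ) (hline t ht).1 (hline t ht).2.1).1.trans (hline t ht).2.2)
    (fun i t ht => ((hrad ℓ t (d ℓ) (hline t ht).1 (hline t ht).2.1).2 i).trans (hline t ht).2.2)
    hzℓ hd2 (by
      rw [le_div_iff₀ (by positivity)] at hd3
      linarith)
  refine ⟨h1, h2.trans ?_⟩
  rw [← hP]
  have e1 : P * ‖d ℓ‖ ≤ κ / 2 := by
    rw [le_div_iff₀ (by positivity)] at hd4
    linarith
  have e2 : m * (κ / (2 * (Q + 1)) * (B + A ^ 2 / c)) ≤ κ / 2 := by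
    have : m * (κ / (2 * (Q + 1)) * (B + A ^ 2 / c)) = κ * Q / (2 * (Q + 1)) := by
      rw [hQ]; ring
    rw [this, div_le_div_iff₀ (by positivity) (by positivity)]
    nlinarith
  calc _ = (P * ‖d ℓ‖ + m * (κ / (2 * (Q + 1)) * (B + A ^ 2 / c))) * ‖d ℓ‖ ^ 2 := by ring
    _ ≤ (κ / 2 + κ / 2) * ‖d ℓ‖ ^ 2 := by gcongr
    _ = _ := by ring

/-- The radius cannot shrink after a step on which the model is accurate. -/
theorem radius_le_succ (hset : InnerSetting m f g μ τ κC ω Δmax x z d Δ) {ℓ : ℕ}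
    (hfeas : ∀ i, 0 < g i (x ℓ + d ℓ))
    (hared : predRed μ f g (x ℓ) (z ℓ) (d ℓ) / 4 ≤ aredRed μ f g (x ℓ) (d ℓ)) :
    Δ ℓ ≤ Δ (ℓ + 1) := by
  by_cases he : (3 / 4) * predRed μ f g (x ℓ) (z ℓ) (d ℓ) ≤ aredRed μ f g (x ℓ) (d ℓ) ∧
      ‖d ℓ‖ = Δ ℓ
  · rw [hset.Δ_expand ℓ hfeas he.1 he.2]
    exact le_min (by linarith [(hset.hΔ ℓ).1]) (hset.hΔ ℓ).2
  · rw [hset.Δ_keep ℓ hfeas (not_lt.2 hared) he]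

theorem radius_div_four_le_succ (hset : InnerSetting m f g μ τ κC ω Δmax x z d Δ) {ℓ : ℕ}
    (hfeas : ∀ i, 0 < g i (x ℓ + d ℓ)) : Δ ℓ / 4 ≤ Δ (ℓ + 1) := by
  by_cases h : aredRed μ f g (x ℓ) (d ℓ) < predRed μ f g (x ℓ) (z ℓ) (d ℓ) / 4
  · rw [hset.Δ_shrink ℓ hfeas h]
  · linarith [hset.radius_le_succ hfeas (not_lt.1 h), (hset.hΔ ℓ).1]

theorem radius_succ_le_of_fail (hset : InnerSetting m f g μ τ κC ω Δmax x z d Δ) {ℓ : ℕ}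
    (hpos : 0 < predRed μ f g (x ℓ) (z ℓ) (d ℓ))
    (hdec : ¬((∀ i, 0 < g i (x ℓ + d ℓ)) ∧
      τ * predRed μ f g (x ℓ) (z ℓ) (d ℓ) < aredRed μ f g (x ℓ) (d ℓ))) :
    Δ (ℓ + 1) ≤ max ω (1 / 4) * Δ ℓ := by
  have hΔ := (hset.hΔ ℓ).1
  by_cases hfeas : ∀ i, 0 < g i (x ℓ + d ℓ)
  · have h := not_lt.1 fun h => hdec ⟨hfeas, h⟩
    have hτ := mul_lt_mul_of_pos_right hset.hτ.2 hpos
    rw [hset.Δ_shrink ℓ hfeas (by linarith)]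
    nlinarith [le_max_right ω (1 / 4)]
  · push Not at hfeas
    rw [hset.Δ_infeas ℓ hfeas]
    have := hset.hω.1
    gcongr
    exacts [le_max_left _ _, hset.hdΔ ℓ]

/-- A quadratic lower bound on the predicted reduction keeps the radius away from zero. -/
theorem exists_pos_le_radius (hset : InnerSetting m f g μ τ κC ω Δmax x z d Δ)
    (hz : ∀ i, Tendsto (fun ℓ => |z ℓ i - μ / g i (x ℓ)|) atTop (𝓝 0)) {c : ℝ} (hc : 0 < c)
    (hgc : ∀ᶠ ℓ in atTop, ∀ i, c ≤ g i (x ℓ)) {κ : ℝ} (hκ : 0 < κ)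
    (hpred : ∀ᶠ ℓ in atTop, κ * Δ ℓ ^ 2 ≤ predRed μ f g (x ℓ) (z ℓ) (d ℓ)) :
    ∃ r > (0 : ℝ), ∀ᶠ ℓ in atTop, r ≤ Δ ℓ := by
  obtain ⟨δ, hδ, hacc⟩ := hset.exists_abs_aredRed_sub_predRed_le hz hc (κ := κ / 4) (by positivity)
  obtain ⟨N, hN⟩ := eventually_atTop.1 (hgc.and (hpred.and hacc))
  have hω := hset.hω
  refine ⟨min (Δ N) (min (ω * δ) (δ / 4)),
    lt_min (hset.hΔ N).1 (lt_min (mul_pos hω.1 hδ) (by positivity)),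
    eventually_atTop.2 ⟨N, fun ℓ hℓ => ?_⟩⟩
  induction ℓ, hℓ using Nat.le_induction with
  | base => exact min_le_left _ _
  | succ ℓ hℓ ih =>
    obtain ⟨hgℓ, hpℓ, haccℓ⟩ := hN ℓ hℓ
    have hmin := min_le_right (Δ N) (min (ω * δ) (δ / 4))
    have hdΔ := hset.hdΔ ℓ
    by_cases hdδ : ‖d ℓ‖ ≤ δ
    · obtain ⟨hfeas, hab⟩ := haccℓ hgℓ hdδ
      by_cases hΔδ : Δ ℓ ≤ δ
      · refine ih.trans (hset.radius_le_succ hfeas ?_)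
        have hsq : ‖d ℓ‖ ^ 2 ≤ Δ ℓ ^ 2 := by gcongr
        have hκsq := mul_le_mul_of_nonneg_left hsq hκ.le
        have := mul_nonneg hκ.le (sq_nonneg (Δ ℓ))
        linarith [(abs_le.1 hab).1]
      · have := hset.radius_div_four_le_succ hfeas
        linarith [min_le_right (ω * δ) (δ / 4)]
    · by_cases hfeas : ∀ i, 0 < g i (x ℓ + d ℓ)
      · have := hset.radius_div_four_le_succ hfeas
        linarith [min_le_right (ω * δ) (δ / 4)]
      · push Not at hfeas
        rw [hset.Δ_infeas ℓ hfeas]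
        have := mul_le_mul_of_nonneg_left (not_le.1 hdδ).le hω.1.le
        linarith [min_le_left (ω * δ) (δ / 4)]

theorem not_eventually_quadratic_le_predRed (hset : InnerSetting m f g μ τ κC ω Δmax x z d Δ)
    (hz : ∀ i, Tendsto (fun ℓ => |z ℓ i - μ / g i (x ℓ)|) atTop (𝓝 0)) {κ : ℝ} (hκ : 0 < κ) :
    ¬ ∀ᶠ ℓ in atTop, κ * Δ ℓ ^ 2 ≤ predRed μ f g (x ℓ) (z ℓ) (d ℓ) := by
  intro hpred
  obtain ⟨N, hN⟩ := eventually_atTop.1 hpred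
  have hpos : ∀ ℓ ≥ N, 0 < predRed μ f g (x ℓ) (z ℓ) (d ℓ) := fun ℓ hℓ =>
    (mul_pos hκ (pow_pos (hset.hΔ ℓ).1 2)).trans_le (hN ℓ hℓ)
  have hanti : Antitone fun k => barrierPhi μ f g (x (N + k)) :=
    antitone_nat_of_succ_le fun k => hset.barrierPhi_succ_le (hpos (N + k) (by omega)).le
  obtain ⟨b, hb⟩ := hset.barrierPhi_bddBelow
  obtain ⟨c, hc, hgc⟩ := hset.exists_pos_le_constraint (barrierPhi μ f g (x N))
  obtain ⟨r, hr, hrΔ⟩ := hset.exists_pos_le_radius hz hc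
    (eventually_atTop.2 ⟨N, fun ℓ hℓ => hgc ℓ (by
      obtain ⟨k, rfl⟩ := Nat.exists_eq_add_of_le hℓ
      exact hanti k.zero_le)⟩) hκ hpred
  have hlim : Tendsto (fun ℓ => barrierPhi μ f g (x ℓ)) atTop
      (𝓝 (⨅ k, barrierPhi μ f g (x (N + k)))) := by
    rw [← tendsto_add_atTop_iff_nat N]
    simpa only [add_comm N] using
      tendsto_atTop_ciInf hanti ⟨b, by rintro _ ⟨k, rfl⟩; exact hb _⟩
  have hdiff : Tendsto (fun ℓ => barrierPhi μ f g (x ℓ) - barrierPhi μ f g (x (ℓ + 1))) atTop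
      (𝓝 0) := by
    simpa using hlim.sub (hlim.comp (tendsto_add_atTop_nat 1))
  have hτ := hset.hτ.1
  have hshrink : ∀ᶠ ℓ in atTop, Δ (ℓ + 1) ≤ max ω (1 / 4) * Δ ℓ := by
    filter_upwards [hdiff.eventually_lt_const (show 0 < τ * (κ * r ^ 2) by positivity), hrΔ,
      eventually_ge_atTop N] with ℓ hℓ hrℓ hNℓ
    refine hset.radius_succ_le_of_fail (hpos ℓ hNℓ) fun hs => ?_
    rw [hset.succ_update ℓ hs] at hℓ
    have h1 : κ * r ^ 2 ≤ κ * Δ ℓ ^ 2 := by gcongr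
    have h2 := mul_le_mul_of_nonneg_left (h1.trans (hN ℓ hNℓ)) hτ.le
    have h3 := hs.2
    simp only [aredRed] at h3
    linarith
  obtain ⟨M, hM⟩ := eventually_atTop.1 (hshrink.and hrΔ)
  have hρ0 : 0 ≤ max ω (1 / 4) := hset.hω.1.le.trans (le_max_left _ _)
  have hρ1 : max ω (1 / 4) < 1 := max_lt hset.hω.2 (by norm_num)
  have hgeom : ∀ k, Δ (M + k) ≤ max ω (1 / 4) ^ k * Δ M := by
    intro k
    induction k with
    | zero => simp
    | succ k ih =>
      calc Δ (M + k + 1) ≤ max ω (1 / 4) * Δ (M + k) := (hM (M + k) (by omega)).1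
        _ ≤ max ω (1 / 4) * (max ω (1 / 4) ^ k * Δ M) := by gcongr
        _ = _ := by ring
  have hto0 := (tendsto_pow_atTop_nhds_zero_of_lt_one hρ0 hρ1).mul_const (Δ M)
  rw [zero_mul] at hto0
  exact hr.not_ge (ge_of_tendsto' hto0 fun k => (hM (M + k) (by omega)).2.trans (hgeom k))

end InnerSetting

/-- Under the inner-iteration setting, with the dual convergence
condition and the eigenstep decrease condition, `limsup_{ℓ→∞} λ_min[H(x^ℓ,z^ℓ)] ≥ 0`. -/
theorem inner_limsup_lamMin_nonneg
    {E : Type*} [NormedAddCommGroup E] [InnerProductSpace ℝ E] [FiniteDimensional ℝ E]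
    [Nontrivial E] {m : ℕ}
    (f : E → ℝ) (g : Fin m → E → ℝ) (μ τ κC ω Δmax : ℝ)
    (x : ℕ → E) (z : ℕ → Fin m → ℝ) (d : ℕ → E) (Δ : ℕ → ℝ)
    (hset : InnerSetting m f g μ τ κC ω Δmax x z d Δ)
    (hz : ∀ i, Tendsto (fun ℓ => |z ℓ i - μ / g i (x ℓ)|) atTop (𝓝 0))
    (heig : ∃ κE > (0:ℝ), ∀ ε > (0:ℝ), ∀ ℓ, lamMin (Hxz f g (x ℓ) (z ℓ)) < -ε →
      κE * ε * (Δ ℓ) ^ 2 ≤ predRed μ f g (x ℓ) (z ℓ) (d ℓ)) :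
    0 ≤ limsup (fun ℓ => lamMin (Hxz f g (x ℓ) (z ℓ))) atTop := by
  by_contra hlt
  obtain ⟨κE, hκE, heig⟩ := heig
  have hne : {a | ∀ᶠ ℓ in atTop, lamMin (Hxz f g (x ℓ) (z ℓ)) ≤ a}.Nonempty := by
    by_contra hemp
    rw [Set.not_nonempty_iff_eq_empty] at hemp
    rw [limsup_eq, hemp, Real.sInf_empty] at hlt
    exact hlt le_rfl
  rw [limsup_eq, not_le] at hlt
  obtain ⟨a, ha, ha0⟩ := exists_lt_of_csInf_lt hne hlt
  refine hset.not_eventually_quadratic_le_predRed hz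
    (κ := κE * (-a / 2)) (mul_pos hκE (by linarith)) ?_
  filter_upwards [ha] with ℓ hℓ
  exact heig (-a / 2) (by linarith) ℓ (by linarith)

end
end

section
/- Fix x ∈ E with g_i(x) > 0 for all i, z ∈ ℝ^m with z_i > 0 for all i, and μ > 0. Then there exist α > 0 and δ > 0 such that for every d ∈ E with ‖d‖ ≤ δ, |pred_{x,z,μ}(d) − ared_{x,μ}(d)| ≤ α ‖d‖². -/
open Filter Topology
open scoped RealInnerProductSpace BigOperators

noncomputable section

variable {E : Type*} [NormedAddCommGroup E] [InnerProductSpace ℝ E] [FiniteDimensional ℝ E]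

/-- First-order Taylor expansion with quadratic remainder at a point of `C²` regularity. -/
lemma exists_taylor_quadratic_bound {F : Type*} [NormedAddCommGroup F] [NormedSpace ℝ F]
    {ψ : F → ℝ} {x : F} (h : ContDiffAt ℝ 2 ψ x) :
    ∃ C > (0:ℝ), ∃ δ > (0:ℝ), ∀ d : F, ‖d‖ ≤ δ →
      |ψ (x + d) - ψ x - fderiv ℝ ψ x d| ≤ C * ‖d‖ ^ 2 := by
  have h1 : DifferentiableAt ℝ (fderiv ℝ ψ) x :=
    (h.fderiv_right (m := 1) (by norm_num)).differentiableAt (by norm_num)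
  obtain ⟨C, hC, hO⟩ := h1.isBigO_sub.exists_pos
  have hd : ∀ᶠ y in 𝓝 x, DifferentiableAt ℝ ψ y :=
    (h.eventually (by simp)).mono fun y hy => hy.differentiableAt (by norm_num)
  obtain ⟨ε, hε, hball⟩ := Metric.eventually_nhds_iff.1 (hO.bound.and hd)
  refine ⟨C, hC, ε / 2, half_pos hε, fun d hdε => ?_⟩
  have hmem : ∀ y ∈ Metric.closedBall x ‖d‖, dist y x < ε := fun y hy =>
    (Metric.mem_closedBall.1 hy).trans_lt (by linarith)
  have key := (convex_closedBall x ‖d‖).norm_image_sub_le_of_norm_fderiv_le'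
    (f := ψ) (φ := fderiv ℝ ψ x) (C := C * ‖d‖) (x := x) (y := x + d)
    (fun y hy => (hball (hmem y hy)).2)
    (fun y hy => (hball (hmem y hy)).1.trans
      (mul_le_mul_of_nonneg_left (mem_closedBall_iff_norm.1 hy) hC.le))
    (by simp) (by simp)
  rw [add_sub_cancel_left, Real.norm_eq_abs] at key
  linarith [key]

lemma contDiffAt_barrierPhi {m : ℕ} (μ : ℝ) {f : E → ℝ} {g : Fin m → E → ℝ} {x : E}
    {n : WithTop ℕ∞} (hf : ContDiffAt ℝ n f x) (hg : ∀ i, ContDiffAt ℝ n (g i) x)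
    (hgx : ∀ i, g i x ≠ 0) : ContDiffAt ℝ n (barrierPhi μ f g) x :=
  hf.sub (contDiffAt_const.mul (ContDiffAt.sum fun i _ => (hg i).log (hgx i)))

lemma fderiv_barrierPhi_apply {m : ℕ} (μ : ℝ) {f : E → ℝ} {g : Fin m → E → ℝ} {x : E}
    (hf : DifferentiableAt ℝ f x) (hg : ∀ i, DifferentiableAt ℝ (g i) x)
    (hgx : ∀ i, g i x ≠ 0) (d : E) :
    fderiv ℝ (barrierPhi μ f g) x d = ⟪qmu μ f g x, d⟫ := by
  have h : HasFDerivAt (barrierPhi μ f g)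
      (fderiv ℝ f x - μ • ∑ i, (g i x)⁻¹ • fderiv ℝ (g i) x) x :=
    hf.hasFDerivAt.sub
      ((HasFDerivAt.fun_sum fun i _ => (hg i).hasFDerivAt.log (hgx i)).const_mul μ)
  rw [h.fderiv]
  simp [qmu, inner_sub_left, inner_smul_left, sum_inner, gradient]

/-- At a fixed strictly feasible point, the gap between predicted and
actual reduction is quadratically small in the step. -/
theorem pred_ared_gap_quadratic_at_point
    {E : Type*} [NormedAddCommGroup E] [InnerProductSpace ℝ E] [FiniteDimensional ℝ E]
    [Nontrivial E] {m : ℕ} (hm : 1 ≤ m)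
    (f : E → ℝ) (g : Fin m → E → ℝ)
    (hf : ContDiff ℝ 2 f) (hg : ∀ i, ContDiff ℝ 2 (g i))
    (x : E) (z : Fin m → ℝ) (μ : ℝ)
    (hgx : ∀ i, 0 < g i x) (hz : ∀ i, 0 < z i) (hμ : 0 < μ) :
    ∃ α > (0:ℝ), ∃ δ > (0:ℝ), ∀ d : E, ‖d‖ ≤ δ →
      |predRed μ f g x z d - aredRed μ f g x d| ≤ α * ‖d‖ ^ 2 := by
  have hgx' : ∀ i, g i x ≠ 0 := fun i => (hgx i).ne'
  obtain ⟨C, hC, δ, hδ, hT⟩ := exists_taylor_quadratic_bound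
    (contDiffAt_barrierPhi μ hf.contDiffAt (fun i => (hg i).contDiffAt) hgx')
  refine ⟨C + ‖Hxz f g x z‖, by positivity, δ, hδ, fun d hd => ?_⟩
  have hT := hT d hd
  rw [fderiv_barrierPhi_apply μ (hf.differentiable (by norm_num) x)
    (fun i => (hg i).differentiable (by norm_num) x) hgx' d] at hT
  have hH : |⟪Hxz f g x z d, d⟫| ≤ ‖Hxz f g x z‖ * ‖d‖ ^ 2 := by
    calc |⟪Hxz f g x z d, d⟫| ≤ ‖Hxz f g x z d‖ * ‖d‖ := abs_real_inner_le_norm _ _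
      _ ≤ ‖Hxz f g x z‖ * ‖d‖ * ‖d‖ := by gcongr; exact (Hxz f g x z).le_opNorm d
      _ = ‖Hxz f g x z‖ * ‖d‖ ^ 2 := by ring
  have hN : 0 ≤ ‖Hxz f g x z‖ * ‖d‖ ^ 2 := by positivity
  simp only [predRed, trModel, aredRed]
  rw [abs_le] at hT hH ⊢
  constructor <;> linarith [hT.1, hT.2, hH.1, hH.2]

end
end

section
/- Fix μ > 0 and constants 0 < c₁ < 1 < c₂. Let x^ℓ ∈ E, d^ℓ ∈ E, z^ℓ ∈ ℝ^m (ℓ ∈ ℕ) and a set S ⊆ ℕ (the successful iterations) be given, with z⁰_i > 0 for all i, and suppose there is ε > 0 with g_i(x^ℓ + d^ℓ) ≥ ε for all ℓ ∈ S and all i. Suppose the dual variables obey the clipping update: for ℓ ∈ S, z^{ℓ+1}_i = max{a^ℓ_i, min{b^ℓ_i, w^ℓ_i}} for some w^ℓ ∈ ℝ^m, where a^ℓ_i = c₁ · min{1, z^ℓ_i, μ/g_i(x^ℓ + d^ℓ)} and b^ℓ_i = max{c₂, z^ℓ_i, c₂/μ, c₂/g_i(x^ℓ + d^ℓ)}; and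 z^{ℓ+1} = z^ℓ for ℓ ∉ S. Then for every ℓ and every i: 0 < z^ℓ_i ≤ max{c₂, z⁰_i, c₂/μ, c₂/ε}. -/
open Filter Topology

/-- Positivity and uniform boundedness of the dual variables under the
clipping update rule. -/
theorem clipping_dual_bounds
    {E : Type*} [NormedAddCommGroup E] [InnerProductSpace ℝ E] [FiniteDimensional ℝ E]
    [Nontrivial E] {m : ℕ} (hm : 1 ≤ m)
    (g : Fin m → E → ℝ) (hg : ∀ i, ContDiff ℝ 2 (g i))
    (μ c₁ c₂ : ℝ) (hμ : 0 < μ) (hc₁ : 0 < c₁) (hc₁1 : c₁ < 1) (hc₂ : 1 < c₂)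
    (x : ℕ → E) (d : ℕ → E) (z : ℕ → Fin m → ℝ) (S : Set ℕ)
    (hz0 : ∀ i, 0 < z 0 i)
    (ε : ℝ) (hε : 0 < ε)
    (hgS : ∀ ℓ ∈ S, ∀ i, ε ≤ g i (x ℓ + d ℓ))
    -- clipping update on successful iterations
    (hupd : ∀ ℓ ∈ S, ∃ w : Fin m → ℝ, ∀ i,
      z (ℓ + 1) i =
        max (c₁ * min 1 (min (z ℓ i) (μ / g i (x ℓ + d ℓ))))
          (min (max c₂ (max (z ℓ i) (max (c₂ / μ) (c₂ / g i (x ℓ + d ℓ))))) (w i)))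
    -- no dual update on unsuccessful iterations
    (hfail : ∀ ℓ ∉ S, z (ℓ + 1) = z ℓ) :
    ∀ ℓ i, 0 < z ℓ i ∧ z ℓ i ≤ max c₂ (max (z 0 i) (max (c₂ / μ) (c₂ / ε))) := by
  intro ℓ i
  induction ℓ with
  | zero => exact ⟨hz0 i, (le_max_left _ _).trans (le_max_right _ _)⟩
  | succ ℓ ih =>
    obtain ⟨hpos, hle⟩ := ih
    by_cases hℓ : ℓ ∈ S
    · obtain ⟨w, hw⟩ := hupd ℓ hℓ
      have hgε := hgS ℓ hℓ i
      have hgpos : 0 < g i (x ℓ + d ℓ) := hε.trans_le hgε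
      rw [hw i]
      constructor
      · exact lt_max_of_lt_left
          (mul_pos hc₁ (lt_min one_pos (lt_min hpos (div_pos hμ hgpos))))
      · refine max_le (le_max_of_le_left ?_) ((min_le_left _ _).trans ?_)
        · calc c₁ * min 1 (min (z ℓ i) (μ / g i (x ℓ + d ℓ)))
              ≤ c₁ * 1 := mul_le_mul_of_nonneg_left (min_le_left _ _) hc₁.le
            _ ≤ c₂ := by linarith
        · have hdiv : c₂ / g i (x ℓ + d ℓ) ≤ c₂ / ε :=
            div_le_div_of_nonneg_left (by linarith) hε hgε
          exact max_le (le_max_left _ _) (max_le hle (le_max_of_le_right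
            (le_max_of_le_right (max_le_max le_rfl hdiv))))
    · rw [hfail ℓ hℓ]
      exact ⟨hpos, hle⟩
end
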